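/- The constrained quantization dimension of P exists and equals 2; that is, lim_{n→∞} (2 log n)/(−log(V_n − V_∞)) = 2, where V_n = (4n² + 12n + 13)/(24n²) and V_∞ = lim_{n→∞} V_n = 1/6. -/

import Mathlib

open MeasureTheory

noncomputable section

/-- The Euclidean plane ℝ². -/
abbrev Plane : Type := EuclideanSpace ℝ (Fin 2)

/-- The point (x, y) in the Euclidean plane. -/
def pt (x y : ℝ) : Plane := (WithLp.equiv 2 (Fin 2 → ℝ)).symm ![x, y]

/-- P: the uniform probability measure on the segment J = [0,1] × {0}, i.e. the pushforward
of Lebesgue measure restricted to [0,1] under x ↦ (x, 0). -/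
def P : Measure Plane :=
  Measure.map (fun x : ℝ => pt x 0) (volume.restrict (Set.Icc (0 : ℝ) 1))

/-- The constraint S_j = {(x, x + 1/j) : -1/j ≤ x ≤ 1}. -/
def S (j : ℕ) : Set Plane :=
  {p | ∃ x : ℝ, -(1 / (j : ℝ)) ≤ x ∧ x ≤ 1 ∧ p = pt x (x + 1 / (j : ℝ))}

/-- min_{b ∈ β} ‖y - b‖², written as an infimum over the image set. -/
def minDist (β : Set Plane) (y : Plane) : ℝ :=
  sInf ((fun b => ‖y - b‖ ^ 2) '' β)

/-- The distortion error ∫ min_{b ∈ β} ‖y - b‖² dP(y) of a set β. -/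
def distortion (β : Set Plane) : ℝ := ∫ y, minDist β y ∂P

/-- The n-th constrained quantization error for P with respect to the family (S_j). -/
def Vn (n : ℕ) : ℝ :=
  sInf {v : ℝ | ∃ α : Finset Plane,
    ↑α ⊆ (⋃ j ∈ Finset.Icc 1 n, S j) ∧ 1 ≤ α.card ∧ α.card ≤ n ∧ v = distortion ↑α}

open Filter Topology

lemma norm_pt_sub_pt_sq (x y a b : ℝ) :
    ‖pt x y - pt a b‖ ^ 2 = (x - a) ^ 2 + (y - b) ^ 2 := by
  simp [EuclideanSpace.norm_sq_eq, Fin.sum_univ_two, pt]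

lemma continuous_pt_zero : Continuous fun x : ℝ => pt x 0 := by
  refine (PiLp.continuous_toLp 2 _).comp (continuous_pi fun i => ?_)
  fin_cases i
  · exact continuous_id
  · exact continuous_const

lemma continuous_minDist {α : Finset Plane} (hα : α.Nonempty) :
    Continuous (minDist (α : Set Plane)) := by
  have h : minDist (α : Set Plane) = fun y => α.inf' hα fun b => ‖y - b‖ ^ 2 := by
    funext y
    rw [Finset.inf'_eq_csInf_image]
    rfl
  rw [h]
  exact Continuous.finset_inf'_apply hα fun b _ => by fun_prop

lemma minDist_le {α : Set Plane} {y b : Plane} (hb : b ∈ α) : minDist α y ≤ ‖y - b‖ ^ 2 :=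
  csInf_le ⟨0, by rintro _ ⟨c, -, rfl⟩; positivity⟩ ⟨b, hb, rfl⟩

lemma distortion_eq_intervalIntegral {α : Finset Plane} (hα : α.Nonempty) :
    distortion (α : Set Plane) = ∫ x in (0 : ℝ)..1, minDist (α : Set Plane) (pt x 0) := by
  rw [distortion, P, integral_map continuous_pt_zero.aemeasurable
    (continuous_minDist hα).aestronglyMeasurable, intervalIntegral.integral_of_le zero_le_one,
    integral_Icc_eq_integral_Ioc]

lemma intervalIntegral_add_sq_div_two_add (d c : ℝ) :
    ∫ x in (0 : ℝ)..1, ((x + d) ^ 2 / 2 + c) = 1 / 6 + d / 2 + d ^ 2 / 2 + c := by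
  have h (x : ℝ) (_ : x ∈ Set.uIcc (0 : ℝ) 1) :
      HasDerivAt (fun x : ℝ => (x + d) ^ 3 / 6 + c * x) ((x + d) ^ 2 / 2 + c) x := by
    refine (((((hasDerivAt_id' x).add_const d).fun_pow 3).div_const 6).fun_add
      ((hasDerivAt_id' x).const_mul c)).congr_deriv ?_
    norm_num
    ring
  rw [intervalIntegral.integral_eq_sub_of_hasDerivAt h (by
    apply Continuous.intervalIntegrable; fun_prop)]
  ring

/-- A point of the lines `S j`, `1 ≤ j ≤ n`, is at least as far from `(x, 0)` as the line `S n`. -/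
lemma add_sq_div_two_le_norm_sq {n : ℕ} {b : Plane} (hb : b ∈ ⋃ j ∈ Finset.Icc 1 n, S j)
    {x : ℝ} (hx : 0 ≤ x) : (x + 1 / (n : ℝ)) ^ 2 / 2 ≤ ‖pt x 0 - b‖ ^ 2 := by
  simp only [Set.mem_iUnion, Finset.mem_Icc] at hb
  obtain ⟨j, ⟨hj, hjn⟩, a, -, -, rfl⟩ := hb
  rw [norm_pt_sub_pt_sq]
  have hj' : (0 : ℝ) < j := by exact_mod_cast hj
  have hle : 1 / (n : ℝ) ≤ 1 / j := one_div_le_one_div_of_le hj' (by exact_mod_cast hjn)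
  have h0 : (0 : ℝ) ≤ 1 / n := by positivity
  have hsq : (x + 1 / (n : ℝ)) ^ 2 ≤ (x + 1 / (j : ℝ)) ^ 2 := by gcongr
  nlinarith [sq_nonneg (x - 2 * a - 1 / (j : ℝ))]

lemma le_distortion {n : ℕ} {α : Finset Plane} (hα : α.Nonempty)
    (hS : (α : Set Plane) ⊆ ⋃ j ∈ Finset.Icc 1 n, S j) :
    1 / 6 + 1 / (2 * (n : ℝ)) ≤ distortion (α : Set Plane) := by
  have hint := intervalIntegral_add_sq_div_two_add (1 / (n : ℝ)) 0
  have hmono : ∫ x in (0 : ℝ)..1, ((x + 1 / (n : ℝ)) ^ 2 / 2 + 0)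
      ≤ ∫ x in (0 : ℝ)..1, minDist (α : Set Plane) (pt x 0) := by
    refine intervalIntegral.integral_mono_on zero_le_one
      (by apply Continuous.intervalIntegrable; fun_prop)
      (((continuous_minDist hα).comp continuous_pt_zero).intervalIntegrable _ _) fun x hx => ?_
    rw [add_zero]
    refine le_csInf ((Finset.coe_nonempty.2 hα).image _) ?_
    rintro _ ⟨b, hb, rfl⟩
    exact add_sq_div_two_le_norm_sq (hS hb) hx.1
  rw [distortion_eq_intervalIntegral hα]
  have h2 : 1 / (2 * (n : ℝ)) = 1 / n / 2 := by rw [div_div, mul_comm]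
  have : 0 ≤ (1 / (n : ℝ)) ^ 2 / 2 := by positivity
  linarith

/-- The points of `S n` closest to `(i / n, 0)`, for `0 ≤ i < n`. -/
def quantizer (n : ℕ) : Finset Plane :=
  open Classical in
  (Finset.range n).image fun i : ℕ =>
    pt (((i : ℝ) / n - 1 / n) / 2) (((i : ℝ) / n - 1 / n) / 2 + 1 / n)

lemma quantizer_nonempty {n : ℕ} (hn : 0 < n) : (quantizer n).Nonempty := by
  simpa [quantizer] using hn.ne'

lemma card_quantizer_le (n : ℕ) : (quantizer n).card ≤ n :=
  Finset.card_image_le.trans_eq (Finset.card_range n)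

lemma quantizer_subset {n : ℕ} (hn : 0 < n) :
    (quantizer n : Set Plane) ⊆ ⋃ j ∈ Finset.Icc 1 n, S j := by
  intro p hp
  simp only [quantizer, Finset.coe_image, Set.mem_image, Finset.mem_coe, Finset.mem_range] at hp
  obtain ⟨i, hi, rfl⟩ := hp
  simp only [Set.mem_iUnion, Finset.mem_Icc]
  have hn' : (0 : ℝ) < n := by exact_mod_cast hn
  have h0 : (0 : ℝ) ≤ i / n := by positivity
  have h1 : (i : ℝ) / n ≤ 1 := (div_le_one hn').2 (by exact_mod_cast hi.le)
  have h2 : (0 : ℝ) < 1 / n := by positivity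
  exact ⟨n, ⟨hn, le_rfl⟩, _, by linarith, by linarith, rfl⟩

lemma exists_lt_abs_sub_div_le {n : ℕ} (hn : 0 < n) {x : ℝ} (hx : x ∈ Set.Icc (0 : ℝ) 1) :
    ∃ i < n, |x - (i : ℝ) / n| ≤ 1 / n := by
  have hn' : (0 : ℝ) < n := by exact_mod_cast hn
  rcases hx.2.eq_or_lt with rfl | hx1
  · refine ⟨n - 1, by omega, ?_⟩
    rw [Nat.cast_sub hn, Nat.cast_one, sub_div, div_self hn'.ne', sub_sub_cancel,
      abs_of_pos (by positivity)]
  · have hnx : 0 ≤ n * x := mul_nonneg hn'.le hx.1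
    refine ⟨⌊n * x⌋₊, (Nat.floor_lt hnx).2 (by nlinarith), ?_⟩
    have h1 := Nat.floor_le hnx
    have h2 := Nat.lt_floor_add_one (n * x)
    have h3 : x - (⌊n * x⌋₊ : ℝ) / n = (n * x - ⌊n * x⌋₊) / n := by field_simp
    rw [h3, abs_of_nonneg (div_nonneg (by linarith) hn'.le)]
    gcongr
    linarith

lemma distortion_quantizer_le {n : ℕ} (hn : 0 < n) :
    distortion (quantizer n : Set Plane) ≤ 1 / 6 + 3 / 2 / (n : ℝ) := by
  have hne := quantizer_nonempty hn
  have hint := intervalIntegral_add_sq_div_two_add (1 / (n : ℝ)) ((1 / (n : ℝ)) ^ 2 / 2)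
  have hmono : ∫ x in (0 : ℝ)..1, minDist (quantizer n : Set Plane) (pt x 0)
      ≤ ∫ x in (0 : ℝ)..1, ((x + 1 / (n : ℝ)) ^ 2 / 2 + (1 / (n : ℝ)) ^ 2 / 2) := by
    refine intervalIntegral.integral_mono_on zero_le_one
      (((continuous_minDist hne).comp continuous_pt_zero).intervalIntegrable _ _)
      (by apply Continuous.intervalIntegrable; fun_prop) fun x hx => ?_
    obtain ⟨i, hi, hxi⟩ := exists_lt_abs_sub_div_le hn hx
    refine (minDist_le (b := pt (((i : ℝ) / n - 1 / n) / 2)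
      (((i : ℝ) / n - 1 / n) / 2 + 1 / n)) ?_).trans ?_
    · simp only [quantizer, Finset.coe_image, Set.mem_image, Finset.mem_coe, Finset.mem_range]
      exact ⟨i, hi, rfl⟩
    · rw [norm_pt_sub_pt_sq]
      have := pow_le_pow_left₀ (abs_nonneg _) hxi 2
      rw [sq_abs] at this
      linarith
  rw [distortion_eq_intervalIntegral hne]
  have h1 : 1 / (n : ℝ) ≤ 1 := (div_le_one (by exact_mod_cast hn)).2 (by exact_mod_cast hn)
  have h0 : 0 ≤ 1 / (n : ℝ) := by positivity
  have h3 : 3 / 2 / (n : ℝ) = 3 / 2 * (1 / n) := by ring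
  nlinarith

lemma le_Vn {n : ℕ} (hn : 0 < n) : 1 / 2 / (n : ℝ) ≤ Vn n - 1 / 6 := by
  have h : 1 / 6 + 1 / (2 * (n : ℝ)) ≤ Vn n := by
    refine le_csInf ⟨_, quantizer n, quantizer_subset hn,
      (quantizer_nonempty hn).card_pos, card_quantizer_le n, rfl⟩ ?_
    rintro _ ⟨α, hS, hα, -, rfl⟩
    exact le_distortion (Finset.card_pos.1 hα) hS
  rw [div_div]
  linarith

lemma Vn_le {n : ℕ} (hn : 0 < n) : Vn n - 1 / 6 ≤ 3 / 2 / (n : ℝ) := by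
  have h : Vn n ≤ distortion (quantizer n : Set Plane) := by
    refine csInf_le ⟨1 / 6 + 1 / (2 * (n : ℝ)), ?_⟩ ⟨quantizer n, quantizer_subset hn,
      (quantizer_nonempty hn).card_pos, card_quantizer_le n, rfl⟩
    rintro _ ⟨α, hS, hα, -, rfl⟩
    exact le_distortion (Finset.card_pos.1 hα) hS
  linarith [distortion_quantizer_le hn]

/-- A sequence of exact order `1 / n` has logarithmic decay rate `1`. -/
lemma tendsto_two_mul_log_div_neg_log {u : ℕ → ℝ} {c C : ℝ} (hc : 0 < c)
    (hl : ∀ᶠ n : ℕ in atTop, c / n ≤ u n) (hu : ∀ᶠ n : ℕ in atTop, u n ≤ C / n) :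
    Tendsto (fun n : ℕ => (2 * Real.log n) / (-Real.log (u n))) atTop (𝓝 2) := by
  have hlog : Tendsto (fun n : ℕ => Real.log n) atTop atTop :=
    Real.tendsto_log_atTop.comp tendsto_natCast_atTop_atTop
  have hlim (K : ℝ) :
      Tendsto (fun n : ℕ => 1 - Real.log K / Real.log n) atTop (𝓝 1) := by
    simpa using (tendsto_const_nhds (x := (1 : ℝ))).sub
      ((tendsto_const_nhds (x := Real.log K)).div_atTop hlog)
  have hratio : Tendsto (fun n : ℕ => -Real.log (u n) / Real.log n) atTop (𝓝 1) := by
    refine tendsto_of_tendsto_of_tendsto_of_le_of_le' (hlim C) (hlim c) ?_ ?_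
    · filter_upwards [hl, hu, hlog.eventually_gt_atTop 0, eventually_gt_atTop 0]
        with n hln hun hpos hn
      have hn' : (0 : ℝ) < n := by exact_mod_cast hn
      have hun0 : 0 < u n := (div_pos hc hn').trans_le hln
      have hC : C ≠ 0 := by
        rintro rfl
        simp only [zero_div] at hun
        linarith
      have := Real.log_le_log hun0 hun
      rw [Real.log_div hC hn'.ne'] at this
      rw [one_sub_div hpos.ne']
      gcongr
      linarith
    · filter_upwards [hl, hlog.eventually_gt_atTop 0, eventually_gt_atTop 0]
        with n hln hpos hn
      have hn' : (0 : ℝ) < n := by exact_mod_cast hn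
      have := Real.log_le_log (div_pos hc hn') hln
      rw [Real.log_div hc.ne' hn'.ne'] at this
      rw [one_sub_div hpos.ne']
      gcongr
      linarith
  have h := (tendsto_const_nhds (x := (2 : ℝ))).div hratio one_ne_zero
  rw [div_one] at h
  exact h.congr fun n => div_div_eq_mul_div _ _ _

/-- the constrained quantization dimension of P exists and equals 2, i.e.
lim_{n→∞} (2 log n)/(−log(V_n − V_∞)) = 2 where V_∞ = lim_{n→∞} V_n = 1/6. -/
theorem constrained_quantization_dimension :
    Tendsto (fun n : ℕ => Vn n) atTop (𝓝 (1 / 6 : ℝ)) ∧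
    Tendsto (fun n : ℕ => (2 * Real.log n) / (-Real.log (Vn n - 1 / 6)))
      atTop (𝓝 (2 : ℝ)) := by
  have hl : ∀ᶠ n : ℕ in atTop, 1 / 2 / (n : ℝ) ≤ Vn n - 1 / 6 :=
    (eventually_gt_atTop 0).mono fun _ => le_Vn
  have hu : ∀ᶠ n : ℕ in atTop, Vn n - 1 / 6 ≤ 3 / 2 / (n : ℝ) :=
    (eventually_gt_atTop 0).mono fun _ => Vn_le
  refine ⟨tendsto_sub_nhds_zero_iff.1 ?_, tendsto_two_mul_log_div_neg_log one_half_pos hl hu⟩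
  exact tendsto_of_tendsto_of_tendsto_of_le_of_le' (tendsto_const_div_atTop_nhds_zero_nat _)
    (tendsto_const_div_atTop_nhds_zero_nat _) hl hu

end
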